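/- arXiv:2201.04776 — 2 statements merged into one kernel-verified Lean document; each statement's English description precedes it below -/
import Mathlib

section
/- Let m be a positive integer, q ∈ (1, m+1], and x ∈ I_q := [0, m/(q−1)]. Suppose x has exactly two different q-expansions (a_i) and (b_i) with respect to Ω_m, and suppose a_1⋯a_{k−1} = b_1⋯b_{k−1} and b_k > a_k for some k ≥ 1. Then b_k = a_k + 1. -/
/-- A sequence of digits has a last nonzero digit. -/
def hasLastNonzero (c : ℕ → ℕ) : Prop := ∃ n, c n ≠ 0 ∧ ∀ i > n, c i = 0

/-- `c` (with `c i` the `(i+1)`-st digit) is a `q`-expansion of `x`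
with respect to the digit set `Ω_m = {0,1,…,m}`. -/
def isExpansion (m : ℕ) (q : ℝ) (x : ℝ) (c : ℕ → ℕ) : Prop :=
  (∀ i, c i ≤ m) ∧ x = ∑' i : ℕ, (c i : ℝ) / q ^ (i + 1)

/-- The set `U_q` of points of `I_q = [0, m/(q-1)]` with a unique `q`-expansion. -/
def Uq (m : ℕ) (q : ℝ) : Set ℝ :=
  {x | x ∈ Set.Icc 0 ((m : ℝ) / (q - 1)) ∧ ∃! c, isExpansion m q x c}

/-- The set `U'_q` of digit sequences that are unique `q`-expansions. -/
def Uq' (m : ℕ) (q : ℝ) : Set (ℕ → ℕ) :=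
  {c | isExpansion m q (∑' i : ℕ, (c i : ℝ) / q ^ (i + 1)) c ∧
       ∀ d, isExpansion m q (∑' i : ℕ, (c i : ℝ) / q ^ (i + 1)) d → d = c}

/-- `B_2(m)`: bases `q ∈ (1, m+1]` for which some `x ∈ I_q` has exactly two
different `q`-expansions. -/
def B2 (m : ℕ) : Set ℝ :=
  {q | q ∈ Set.Ioc 1 ((m : ℝ) + 1) ∧
    ∃ x ∈ Set.Icc (0 : ℝ) ((m : ℝ) / (q - 1)), ∃ a b : ℕ → ℕ,
      a ≠ b ∧ isExpansion m q x a ∧ isExpansion m q x b ∧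
      ∀ c, isExpansion m q x c → c = a ∨ c = b}

/-- Strict lexicographic order on digit sequences. -/
def lexLt (a b : ℕ → ℕ) : Prop := ∃ n, (∀ i < n, a i = b i) ∧ a n < b n

/-- Lexicographic order on digit sequences. -/
def lexLe (a b : ℕ → ℕ) : Prop := lexLt a b ∨ a = b

/-- `a` is the quasi-greedy `q`-expansion of `1`: the lexicographically largest
`q`-expansion of `1` without a last nonzero digit. -/
def isQuasiGreedy (m : ℕ) (q : ℝ) (a : ℕ → ℕ) : Prop :=
  isExpansion m q 1 a ∧ ¬ hasLastNonzero a ∧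
  ∀ b, isExpansion m q 1 b → ¬ hasLastNonzero b → lexLe b a

/-- `A'_q = {(c_i) ∈ U'_q : c_1 < α_1(q)}`. -/
def Aq' (m : ℕ) (q : ℝ) : Set (ℕ → ℕ) :=
  {c | c ∈ Uq' m q ∧ ∀ a, isQuasiGreedy m q a → c 0 < a 0}

/-- `f_{c,d}(t) = (m+1)/t + Σ_{i≥1} (c_i + d_i) t^{-(i+1)} - m/(t-1)`. -/
noncomputable def fcd (m : ℕ) (c d : ℕ → ℕ) (t : ℝ) : ℝ :=
  ((m : ℝ) + 1) / t + (∑' i : ℕ, ((c i : ℝ) + (d i : ℝ)) / t ^ (i + 2)) - (m : ℝ) / (t - 1)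

/-- `x = q_f(m)`: the largest real root of `q³-(k+2)q²+q-(k+1)=0` if `m = 2k+1`,
and of `q²-(k+1)q-k=0` if `m = 2k`. -/
def isQf (m : ℕ) (x : ℝ) : Prop :=
  (∃ k : ℕ, m = 2 * k + 1 ∧
    x ^ 3 - ((k : ℝ) + 2) * x ^ 2 + x - ((k : ℝ) + 1) = 0 ∧
    ∀ y : ℝ, y ^ 3 - ((k : ℝ) + 2) * y ^ 2 + y - ((k : ℝ) + 1) = 0 → y ≤ x) ∨
  (∃ k : ℕ, m = 2 * k ∧
    x ^ 2 - ((k : ℝ) + 1) * x - (k : ℝ) = 0 ∧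
    ∀ y : ℝ, y ^ 2 - ((k : ℝ) + 1) * y - (k : ℝ) = 0 → y ≤ x)

/-- A doubly infinite sequence: neither it nor its reflection has a last nonzero digit. -/
def doublyInfinite (m : ℕ) (c : ℕ → ℕ) : Prop :=
  ¬ hasLastNonzero c ∧ ¬ hasLastNonzero (fun i => m - c i)

/-- `V_q`: points of `I_q` with at most one doubly infinite `q`-expansion. -/
def Vq (m : ℕ) (q : ℝ) : Set ℝ :=
  {x | x ∈ Set.Icc 0 ((m : ℝ) / (q - 1)) ∧
    ∀ a b : ℕ → ℕ, isExpansion m q x a → isExpansion m q x b →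
      doublyInfinite m a → doublyInfinite m b → a = b}

/-- `U = {q ∈ (1, m+1] : 1 ∈ U_q}`. -/
def Uset (m : ℕ) : Set ℝ := {q | q ∈ Set.Ioc 1 ((m : ℝ) + 1) ∧ (1 : ℝ) ∈ Uq m q}

/-- `V = {q ∈ (1, m+1] : 1 ∈ V_q}`. -/
def Vset (m : ℕ) : Set ℝ := {q | q ∈ Set.Ioc 1 ((m : ℝ) + 1) ∧ (1 : ℝ) ∈ Vq m q}

/-- The generalized golden ratio `G(m)`. -/
noncomputable def Gratio (m : ℕ) : ℝ :=
  if m % 2 = 0 then ((m / 2 : ℕ) : ℝ) + 1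
  else (((m / 2 : ℕ) : ℝ) + 1 +
    Real.sqrt (((m / 2 : ℕ) : ℝ) ^ 2 + 6 * ((m / 2 : ℕ) : ℝ) + 5)) / 2

/-- The set of accumulation points of a set of reals. -/
def accPts (S : Set ℝ) : Set ℝ := {x | AccPt x (Filter.principal S)}

/-- Iterated accumulation-point sets `B_2^{(i)}(m)`. -/
def B2iter (m : ℕ) : ℕ → Set ℝ
  | 0 => B2 m
  | n + 1 => accPts (B2iter m n)

/-- A digit sequence bounded by `m` gives a convergent series in any base `q > 1`, with sum at
most `m / (q - 1)`. -/
theorem summable_and_tsum_le_of_digit_le {m : ℕ} {q : ℝ} (hq : 1 < q) {c : ℕ → ℕ}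
    (hc : ∀ i, c i ≤ m) :
    Summable (fun i => (c i : ℝ) / q ^ (i + 1)) ∧
      ∑' i, (c i : ℝ) / q ^ (i + 1) ≤ (m : ℝ) / (q - 1) := by
  have hq0 : 0 < q := by linarith
  have hq1 : q - 1 ≠ 0 := by linarith
  have hgeom : HasSum (fun i : ℕ => (m : ℝ) / q ^ (i + 1)) ((m : ℝ) / (q - 1)) := by
    have h := (hasSum_geometric_of_lt_one (inv_nonneg.2 hq0.le)
      (inv_lt_one_of_one_lt₀ hq)).mul_left ((m : ℝ) / q)
    have hterm : (fun i : ℕ => (m : ℝ) / q * q⁻¹ ^ i) = fun i => (m : ℝ) / q ^ (i + 1) := by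
      funext i
      rw [inv_pow, pow_succ]
      field_simp
    have htotal : (m : ℝ) / q * (1 - q⁻¹)⁻¹ = m / (q - 1) := by
      rw [← one_div q, one_sub_div hq0.ne', inv_div]
      field_simp
    rwa [hterm, htotal] at h
  have hle : ∀ i, (c i : ℝ) / q ^ (i + 1) ≤ (m : ℝ) / q ^ (i + 1) := fun i => by
    have : (c i : ℝ) ≤ m := by exact_mod_cast hc i
    gcongr
  have hsum : Summable (fun i => (c i : ℝ) / q ^ (i + 1)) :=
    Summable.of_nonneg_of_le (fun i => by positivity) hle hgeom.summable
  exact ⟨hsum, hgeom.tsum_eq ▸ hsum.tsum_le_tsum hle hgeom.summable⟩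

/-- Splitting off the first `n` digits of a `q`-series. -/
theorem tsum_digits_eq_sum_add {m : ℕ} {q : ℝ} (hq : 1 < q) {c : ℕ → ℕ}
    (hc : ∀ i, c i ≤ m) (n : ℕ) :
    ∑' i, (c i : ℝ) / q ^ (i + 1) = ∑ i ∈ Finset.range n, (c i : ℝ) / q ^ (i + 1) +
      (∑' i, (c (i + n) : ℝ) / q ^ (i + 1)) / q ^ n := by
  rw [← (summable_and_tsum_le_of_digit_le hq hc).1.sum_add_tsum_nat_add n, ← tsum_div_const]
  congr 1
  refine tsum_congr fun i => ?_
  rw [div_div, ← pow_add]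
  congr 2
  omega

/-- One step of the greedy algorithm keeps the remainder in `[0, m / (q - 1)]`. -/
theorem exists_digit_remainder_mem {m : ℕ} {q : ℝ} (hq : q ∈ Set.Ioc 1 ((m : ℝ) + 1)) {r : ℝ}
    (hr : r ∈ Set.Icc (0 : ℝ) ((m : ℝ) / (q - 1))) :
    ∃ d ≤ m, q * r - (d : ℝ) ∈ Set.Icc (0 : ℝ) ((m : ℝ) / (q - 1)) := by
  obtain ⟨hq1, hqm⟩ := hq
  obtain ⟨hr0, hrm⟩ := hr
  have hqr : 0 ≤ q * r := mul_nonneg (by linarith) hr0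
  have hpos : 0 < q - 1 := by linarith
  by_cases h : (m : ℝ) ≤ q * r
  · refine ⟨m, le_rfl, by linarith, ?_⟩
    rw [le_div_iff₀ hpos] at hrm ⊢
    nlinarith
  · refine ⟨⌊q * r⌋₊, ?_, by linarith [Nat.floor_le hqr], ?_⟩
    · exact Nat.floor_le_of_le (not_le.1 h).le
    · have hone : 1 ≤ (m : ℝ) / (q - 1) := by rw [le_div_iff₀ hpos]; linarith
      linarith [Nat.lt_floor_add_one (q * r)]

/-- Every point of `[0, m / (q - 1)]` has a `q`-expansion when `1 < q ≤ m + 1`. -/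
theorem exists_isExpansion {m : ℕ} {q : ℝ} (hq : q ∈ Set.Ioc 1 ((m : ℝ) + 1)) {y : ℝ}
    (hy : y ∈ Set.Icc (0 : ℝ) ((m : ℝ) / (q - 1))) : ∃ c, isExpansion m q y c := by
  have hq1 : 1 < q := hq.1
  have hq0 : 0 < q := by linarith
  choose digit hdm hdr using fun r : Set.Icc (0 : ℝ) ((m : ℝ) / (q - 1)) =>
    exists_digit_remainder_mem hq r.2
  let rem : ℕ → Set.Icc (0 : ℝ) ((m : ℝ) / (q - 1)) :=
    Nat.rec (motive := fun _ => Set.Icc (0 : ℝ) ((m : ℝ) / (q - 1))) ⟨y, hy⟩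
      fun _ r => ⟨q * (r : ℝ) - digit r, hdr r⟩
  have hsucc (n : ℕ) : (rem (n + 1)).1 = q * (rem n).1 - digit (rem n) := rfl
  have hpartial (n : ℕ) :
      ∑ i ∈ Finset.range n, (digit (rem i) : ℝ) / q ^ (i + 1) = y - (rem n).1 / q ^ n := by
    induction n with
    | zero => simp [rem]
    | succ n ih =>
      rw [Finset.sum_range_succ, ih, hsucc]
      field_simp
      ring
  refine ⟨fun n => digit (rem n), fun n => hdm _, HasSum.tsum_eq ?_ |>.symm⟩
  rw [hasSum_iff_tendsto_nat_of_nonneg (fun i => by positivity)]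
  simp only [hpartial]
  have hlim : Filter.Tendsto (fun n => (rem n).1 / q ^ n) Filter.atTop (nhds 0) := by
    refine squeeze_zero (g := fun n => (m : ℝ) / (q - 1) / q ^ n)
      (fun n => div_nonneg (rem n).2.1 (by positivity))
      (fun n => div_le_div_of_nonneg_right (rem n).2.2 (by positivity)) ?_
    exact (tendsto_pow_atTop_atTop_of_one_lt hq1).const_div_atTop _
  simpa using hlim.const_sub y

/-- If `x` has exactly two `q`-expansions agreeing up to digit
`k-1` with `b_k > a_k`, then `b_k = a_k + 1`. -/
theorem stmt1 (m : ℕ) (hm : 0 < m) (q : ℝ) (hq : q ∈ Set.Ioc 1 ((m : ℝ) + 1))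
    (x : ℝ) (hx : x ∈ Set.Icc (0 : ℝ) ((m : ℝ) / (q - 1)))
    (a b : ℕ → ℕ) (hab : a ≠ b)
    (ha : isExpansion m q x a) (hb : isExpansion m q x b)
    (honly : ∀ c, isExpansion m q x c → c = a ∨ c = b)
    (k : ℕ) (hk : 1 ≤ k)
    (hpre : ∀ i < k - 1, a i = b i) (hbk : a (k - 1) < b (k - 1)) :
    b (k - 1) = a (k - 1) + 1 := by
  obtain ⟨n, rfl⟩ : ∃ n, k = n + 1 := ⟨k - 1, by omega⟩
  simp only [Nat.add_sub_cancel] at hpre hbk ⊢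
  by_contra hne
  have hgap : a n + 2 ≤ b n := by omega
  have hq1 : 1 < q := hq.1
  have hq0 : 0 < q := by linarith
  have hA := tsum_digits_eq_sum_add hq1 ha.1 (n + 1)
  have hB := tsum_digits_eq_sum_add hq1 hb.1 (n + 1)
  rw [← ha.2, Finset.sum_range_succ] at hA
  rw [← hb.2, Finset.sum_range_succ, Finset.sum_congr rfl (fun i hi => by
    rw [← hpre i (Finset.mem_range.1 hi)] : ∀ i ∈ Finset.range n,
      (b i : ℝ) / q ^ (i + 1) = (a i : ℝ) / q ^ (i + 1))] at hB
  have hAle := (summable_and_tsum_le_of_digit_le hq1 fun i => ha.1 (i + (n + 1))).2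
  have hB0 : 0 ≤ ∑' i, (b (i + (n + 1)) : ℝ) / q ^ (i + 1) :=
    tsum_nonneg fun i => by positivity
  set A := ∑' i, (a (i + (n + 1)) : ℝ) / q ^ (i + 1)
  set B := ∑' i, (b (i + (n + 1)) : ℝ) / q ^ (i + 1)
  have htail : (a n : ℝ) + A = b n + B := by
    have h : ((a n : ℝ) + A) / q ^ (n + 1) = (b n + B) / q ^ (n + 1) := by
      rw [add_div, add_div]
      linarith
    exact (div_left_inj' (by positivity)).1 h
  have hgap' : (a n : ℝ) + 2 ≤ b n := by exact_mod_cast hgap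
  obtain ⟨d, hdm, hd⟩ := exists_isExpansion hq (y := A - 1) ⟨by linarith, by linarith⟩
  let c : ℕ → ℕ := fun i => if i < n then a i else if i = n then a n + 1 else d (i - (n + 1))
  have hcn : c n = a n + 1 := by simp [c]
  have hclt : ∀ i < n, c i = a i := fun i hi => by simp [c, hi]
  have hcgt (i : ℕ) : c (i + (n + 1)) = d i := by
    simp [c, show ¬ i + (n + 1) < n by omega, show i + (n + 1) ≠ n by omega]
  have hcm (i : ℕ) : c i ≤ m := by
    have := hb.1 n
    have := ha.1 i
    have := hdm (i - (n + 1))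
    simp only [c]
    split_ifs <;> omega
  have hc : isExpansion m q x c := by
    refine ⟨hcm, ?_⟩
    rw [tsum_digits_eq_sum_add hq1 hcm (n + 1), Finset.sum_range_succ, hcn,
      Finset.sum_congr rfl fun i hi => by rw [hclt i (Finset.mem_range.1 hi)]]
    simp only [hcgt]
    rw [← hd, hA]
    push_cast
    ring
  rcases honly c hc with h | h
  · have := congrFun h n
    omega
  · have := congrFun h n
    omega
end

section
/- Let m be a positive integer and q ∈ (1, m+1]. Then q ∈ B_2(m) if and only if there exist sequences c, d ∈ A'_q such that f_{c,d}(q) = 0, i.e. (1c)_q + (md)_q = (m^∞)_q. -/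
/-- The value `Σ c_i q^{-i}` of a digit sequence in base `q`. -/
noncomputable def qval (q : ℝ) (c : ℕ → ℕ) : ℝ := ∑' i : ℕ, (c i : ℝ) / q ^ (i + 1)

/-- The sequence `c` preceded by the digit `j`. -/
def digitCons (j : ℕ) (c : ℕ → ℕ) : ℕ → ℕ
  | 0 => j
  | n + 1 => c n

section Values

variable {m : ℕ} {q : ℝ} {c d : ℕ → ℕ}

lemma summable_digits (hq : 1 < q) (hc : ∀ i, c i ≤ m) :
    Summable fun i : ℕ => (c i : ℝ) / q ^ (i + 1) := by
  have hq0 : 0 < q := by linarith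
  have hgeom : Summable fun i : ℕ => (m : ℝ) * q⁻¹ ^ i :=
    (summable_geometric_of_lt_one (by positivity) (inv_lt_one_of_one_lt₀ hq)).mul_left _
  refine Summable.of_nonneg_of_le (fun i => by positivity) (fun i => ?_) hgeom
  rw [inv_pow, ← div_eq_mul_inv]
  have hci : (c i : ℝ) ≤ m := by exact_mod_cast hc i
  gcongr
  · exact hq.le
  · exact Nat.le_succ i

lemma qval_nonneg (hq : 1 < q) : 0 ≤ qval q c := by
  have hq0 : 0 < q := by linarith
  exact tsum_nonneg fun i => by positivity

lemma mul_qval (hq : 1 < q) (hc : ∀ i, c i ≤ m) :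
    q * qval q c = c 0 + qval q (fun i => c (i + 1)) := by
  have hq0 : q ≠ 0 := by linarith
  unfold qval
  rw [(summable_digits hq hc).tsum_eq_zero_add, mul_add, ← tsum_mul_left]
  congr 1
  · rw [zero_add, pow_one, mul_div_cancel₀ _ hq0]
  · refine tsum_congr fun i => ?_
    rw [pow_succ' q (i + 1), ← mul_div_assoc, mul_div_mul_left _ _ hq0]

lemma mul_qval_digitCons (hq : 1 < q) (hc : ∀ i, c i ≤ m) {j : ℕ} (hj : j ≤ m) :
    q * qval q (digitCons j c) = j + qval q c :=
  mul_qval (m := m) hq (c := digitCons j c) fun i => by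
    cases i
    exacts [hj, hc _]

lemma digitCons_le (hc : ∀ i, c i ≤ m) {j : ℕ} (hj : j ≤ m) (i : ℕ) : digitCons j c i ≤ m := by
  cases i
  exacts [hj, hc _]

lemma digitCons_tail (c : ℕ → ℕ) : digitCons (c 0) (fun i => c (i + 1)) = c := by
  funext i
  cases i <;> rfl

lemma qval_const (hq : 1 < q) : qval q (fun _ => m) = m / (q - 1) := by
  have h := mul_qval (m := m) (c := fun _ => m) hq fun _ => le_rfl
  rw [eq_div_iff (by linarith)]
  linarith

lemma qval_reflect (hq : 1 < q) (hc : ∀ i, c i ≤ m) :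
    qval q (fun i => m - c i) = m / (q - 1) - qval q c := by
  rw [← qval_const hq]
  unfold qval
  rw [← (summable_digits hq fun _ => le_rfl).tsum_sub (summable_digits hq hc)]
  refine tsum_congr fun i => ?_
  rw [Nat.cast_sub (hc i), sub_div]

lemma qval_le (hq : 1 < q) (hc : ∀ i, c i ≤ m) : qval q c ≤ m / (q - 1) := by
  have h := qval_reflect hq hc
  have := qval_nonneg (c := fun i => m - c i) hq
  linarith

lemma eq_zero_of_qval_eq_zero (hq : 1 < q) (hc : ∀ i, c i ≤ m) (h : qval q c = 0) (n : ℕ) :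
    c n = 0 := by
  have key := mul_qval hq hc
  rw [h, mul_zero] at key
  have htail := qval_nonneg (c := fun i => c (i + 1)) hq
  have hhead : (0 : ℝ) ≤ c 0 := by positivity
  induction n generalizing c with
  | zero => exact_mod_cast (by linarith : (c 0 : ℝ) = 0)
  | succ n ih =>
    have h0 : qval q (fun i => c (i + 1)) = 0 := by linarith
    have key' := mul_qval hq fun i => hc (i + 1)
    rw [h0, mul_zero] at key'
    exact ih (c := fun i => c (i + 1)) (fun i => hc _) h0 key' (qval_nonneg hq) (by positivity)

lemma qval_shift_eq (hq : 1 < q) (hc : ∀ i, c i ≤ m) (hd : ∀ i, d i ≤ m)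
    (h : qval q c = qval q d) (n : ℕ) (hn : ∀ i < n, c i = d i) :
    qval q (fun i => c (i + n)) = qval q (fun i => d (i + n)) := by
  induction n with
  | zero => exact h
  | succ n ih =>
    have hcn := mul_qval hq fun i => hc (i + n)
    have hdn := mul_qval hq fun i => hd (i + n)
    rw [ih fun i hi => hn i (by omega)] at hcn
    simp only [zero_add, hn n (Nat.lt_succ_self n)] at hcn hdn
    simp only [show ∀ i, i + (n + 1) = i + 1 + n by omega]
    linarith

/-- A digit sequence produced by bounded remainders is an expansion of the initial remainder. -/
lemma eq_qval_of_remainders (hq : 1 < q) {r : ℕ → ℝ} {M : ℝ} (hr0 : ∀ n, 0 ≤ r n)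
    (hrM : ∀ n, r n ≤ M) (hr : ∀ n, r (n + 1) = q * r n - c n) : r 0 = qval q c := by
  have hq0 : 0 < q := by linarith
  have hpartial : ∀ n, ∑ i ∈ Finset.range n, (c i : ℝ) / q ^ (i + 1) = r 0 - r n / q ^ n := by
    intro n
    induction n with
    | zero => simp
    | succ n ih =>
      rw [Finset.sum_range_succ, ih, hr]
      field_simp
      ring
  have hlim : Filter.Tendsto (fun n => r n / q ^ n) Filter.atTop (nhds 0) := by
    refine squeeze_zero (g := fun n => M * q⁻¹ ^ n) (fun n => div_nonneg (hr0 n) (by positivity))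
      (fun n => ?_) ?_
    · rw [inv_pow, ← div_eq_mul_inv]
      exact div_le_div_of_nonneg_right (hrM n) (by positivity)
    · simpa using (tendsto_pow_atTop_nhds_zero_of_lt_one (by positivity)
        (inv_lt_one_of_one_lt₀ hq)).const_mul M
  have hsum : HasSum (fun i : ℕ => (c i : ℝ) / q ^ (i + 1)) (r 0) := by
    rw [hasSum_iff_tendsto_nat_of_nonneg fun i => by positivity]
    simp only [hpartial]
    simpa using hlim.const_sub (r 0)
  exact hsum.tsum_eq.symm

/-- Every point of `[0, m/(q-1)]` has a `q`-expansion when `q ≤ m+1`. -/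
lemma exists_expansion (hq : q ∈ Set.Ioc 1 ((m : ℝ) + 1)) {x : ℝ}
    (hx : x ∈ Set.Icc 0 ((m : ℝ) / (q - 1))) : ∃ c, (∀ i, c i ≤ m) ∧ qval q c = x := by
  obtain ⟨hq1, hqm⟩ := hq
  set v := (m : ℝ) / (q - 1) with hv
  have hvq : q * v = v + m := by
    rw [hv]
    field_simp [(by linarith : q - 1 ≠ 0)]
    ring
  have hv1 : 1 ≤ v := by
    rw [hv, le_div_iff₀ (by linarith)]
    linarith
  let dig : ℝ → ℕ := fun r => min ⌊q * r⌋₊ m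
  let r : ℕ → ℝ := fun n => Nat.rec x (fun _ r => q * r - dig r) n
  have hr : ∀ n, r n ∈ Set.Icc 0 v := by
    intro n
    induction n with
    | zero => exact hx
    | succ n ih =>
      have hqr : 0 ≤ q * r n := mul_nonneg (by linarith) ih.1
      change q * r n - (dig (r n) : ℝ) ∈ Set.Icc 0 v
      rcases le_total ⌊q * r n⌋₊ m with h | h
      · have hdig : dig (r n) = ⌊q * r n⌋₊ := min_eq_left h
        rw [hdig]
        have h1 := Nat.floor_le hqr
        have h2 := Nat.lt_floor_add_one (q * r n)
        constructor <;> linarith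
      · have hdig : dig (r n) = m := min_eq_right h
        rw [hdig]
        have h1 := (Nat.le_floor_iff hqr).1 h
        have h2 := mul_le_mul_of_nonneg_left ih.2 (by linarith : 0 ≤ q)
        constructor <;> linarith
  exact ⟨fun n => dig (r n), fun n => min_le_right _ _,
    (eq_qval_of_remainders hq1 (fun n => (hr n).1) (fun n => (hr n).2) fun n => rfl).symm⟩

lemma exists_isQuasiGreedy (hq : q ∈ Set.Ioc 1 ((m : ℝ) + 1)) :
    ∃ a, isQuasiGreedy m q a ∧ q - 1 ≤ a 0 ∧ (a 0 : ℝ) < q := by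
  obtain ⟨hq1, hqm⟩ := hq
  let dig : ℝ → ℕ := fun r => ⌈q * r⌉₊ - 1
  let r : ℕ → ℝ := fun n => Nat.rec 1 (fun _ r => q * r - dig r) n
  have hdig : ∀ s : ℝ, 0 < s → q * s - 1 ≤ dig s ∧ (dig s : ℝ) < q * s := by
    intro s hs
    have hqs : 0 < q * s := mul_pos (by linarith) hs
    have hpos : 1 ≤ ⌈q * s⌉₊ := Nat.ceil_pos.2 hqs
    have hcast : (dig s : ℝ) = ⌈q * s⌉₊ - 1 := by
      simp only [dig]
      push_cast [Nat.cast_sub hpos]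
      rfl
    have h1 := Nat.le_ceil (q * s)
    have h2 := Nat.ceil_lt_add_one hqs.le
    constructor <;> linarith
  have hr : ∀ n, 0 < r n ∧ r n ≤ 1 := by
    intro n
    induction n with
    | zero => exact ⟨one_pos, le_rfl⟩
    | succ n ih =>
      obtain ⟨h1, h2⟩ := hdig (r n) ih.1
      change 0 < q * r n - (dig (r n) : ℝ) ∧ q * r n - (dig (r n) : ℝ) ≤ 1
      constructor <;> linarith
  have hstep : ∀ n, r (n + 1) = q * r n - dig (r n) := fun n => rfl
  set a : ℕ → ℕ := fun n => dig (r n) with ha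
  have ham : ∀ i, a i ≤ m := by
    intro i
    have h1 := (hdig (r i) (hr i).1).2
    have h2 := mul_le_mul_of_nonneg_left (hr i).2 (by linarith : 0 ≤ q)
    have h3 : (a i : ℝ) < (m + 1 : ℕ) := by
      push_cast
      simp only [ha]
      linarith
    exact Nat.lt_succ_iff.1 (by exact_mod_cast h3)
  have hshift : ∀ n, r n = qval q (fun i => a (i + n)) := by
    intro n
    have := eq_qval_of_remainders (r := fun i => r (i + n)) (c := fun i => a (i + n)) hq1
      (fun i => (hr _).1.le) (fun i => (hr _).2)
      (fun i => by rw [show i + 1 + n = i + n + 1 by omega, hstep])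
    simpa using this
  refine ⟨a, ⟨⟨ham, hshift 0⟩, ?_, ?_⟩, ?_, ?_⟩
  · rintro ⟨n, -, hn⟩
    have h := hshift (n + 1)
    have hz : (fun i => a (i + (n + 1))) = fun _ => 0 := by
      funext i
      exact hn (i + (n + 1)) (by omega)
    rw [hz] at h
    have := (hr (n + 1)).1
    simp [qval] at h
    linarith
  · rintro b ⟨hbm, hb⟩ hinf
    by_cases hab : b = a
    · exact Or.inr hab
    left
    have hex : ∃ n, b n ≠ a n := Function.ne_iff.1 hab
    classical
    refine ⟨Nat.find hex, fun i hi => by simpa using Nat.find_min hex hi, ?_⟩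
    set n := Nat.find hex
    have hne : b n ≠ a n := Nat.find_spec hex
    have hpre : ∀ i < n, b i = a i := fun i hi => by simpa using Nat.find_min hex hi
    by_contra hlt
    have hgt : a n + 1 ≤ b n := by omega
    refine hinf ⟨n, by omega, ?_⟩
    have hval : qval q b = qval q a := hb.symm.trans (hshift 0)
    have h1 := qval_shift_eq hq1 hbm ham hval n hpre
    rw [← hshift] at h1
    have h2 := mul_qval hq1 fun i => hbm (i + n)
    simp only [zero_add] at h2
    rw [h1] at h2
    have h3 := hstep n
    have h4 := (hr (n + 1)).2
    have h5 : (a n : ℝ) + 1 ≤ b n := by exact_mod_cast hgt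
    have h6 := qval_nonneg (c := fun i => b (i + 1 + n)) hq1
    simp only [ha] at h5
    have h7 : qval q (fun i => b (i + 1 + n)) = 0 := by linarith
    intro i hi
    have := eq_zero_of_qval_eq_zero hq1 (fun i => hbm _) h7 (i - (n + 1))
    rwa [show i - (n + 1) + 1 + n = i by omega] at this
  · have := (hdig (r 0) (hr 0).1).1
    simpa [r, ha] using this
  · have := (hdig (r 0) (hr 0).1).2
    simpa [r, ha] using this

lemma sub_one_le_of_isQuasiGreedy (hq : q ∈ Set.Ioc 1 ((m : ℝ) + 1)) {a : ℕ → ℕ}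
    (ha : isQuasiGreedy m q a) : q - 1 ≤ a 0 := by
  obtain ⟨b, hb, hb0, -⟩ := exists_isQuasiGreedy hq
  have hle : b 0 ≤ a 0 := by
    rcases ha.2.2 b hb.1 hb.2.1 with ⟨n, hn, hlt⟩ | h
    · rcases Nat.eq_zero_or_pos n with rfl | hpos
      · exact hlt.le
      · exact (hn 0 hpos).le
    · rw [h]
  have : (b 0 : ℝ) ≤ a 0 := by exact_mod_cast hle
  linarith

lemma mem_Uq'_iff : c ∈ Uq' m q ↔
    (∀ i, c i ≤ m) ∧ ∀ d : ℕ → ℕ, (∀ i, d i ≤ m) → qval q d = qval q c → d = c :=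
  ⟨fun h => ⟨h.1.1, fun d hd hdc => h.2 d ⟨hd, hdc.symm⟩⟩,
    fun h => ⟨⟨h.1, rfl⟩, fun d hd => h.2 d hd.1 hd.2.symm⟩⟩

lemma reflect_mem_Uq' (hq : 1 < q) (hc : c ∈ Uq' m q) : (fun i => m - c i) ∈ Uq' m q := by
  rw [mem_Uq'_iff] at hc ⊢
  refine ⟨fun i => Nat.sub_le _ _, fun d hd h => ?_⟩
  have hd' := hc.2 (fun i => m - d i) (fun i => Nat.sub_le _ _) (by
    rw [qval_reflect hq hd, h, qval_reflect hq hc.1]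
    ring)
  funext i
  have h1 : m - d i = c i := congrFun hd' i
  have h2 := hd i
  change d i = m - c i
  omega

lemma qval_tail_lt_one (hq : q ∈ Set.Ioc 1 ((m : ℝ) + 1)) (hc : c ∈ Uq' m q) (h0 : c 0 < m) :
    qval q (fun i => c (i + 1)) < 1 := by
  rw [mem_Uq'_iff] at hc
  by_contra! h
  have hle := qval_le hq.1 fun i => hc.1 (i + 1)
  obtain ⟨g, hg, hgv⟩ := exists_expansion hq
    (x := qval q (fun i => c (i + 1)) - 1) ⟨by linarith, by linarith⟩
  have h1 := mul_qval_digitCons hq.1 hg (j := c 0 + 1) h0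
  have h2 := mul_qval hq.1 hc.1
  have hval : qval q (digitCons (c 0 + 1) g) = qval q c := by
    refine mul_left_cancel₀ (by linarith [hq.1] : q ≠ 0) ?_
    rw [h1, h2, hgv]
    push_cast
    ring
  have := congrFun (hc.2 _ (digitCons_le hg h0) hval) 0
  simp [digitCons] at this

lemma lt_qval_tail_add_one (hq : q ∈ Set.Ioc 1 ((m : ℝ) + 1)) (hc : c ∈ Uq' m q) (h0 : 0 < c 0) :
    (m : ℝ) / (q - 1) < qval q (fun i => c (i + 1)) + 1 := by
  have hcm := (mem_Uq'_iff.1 hc).1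
  have h := qval_tail_lt_one hq (reflect_mem_Uq' hq.1 hc) (by have := hcm 0; omega)
  rw [qval_reflect hq.1 fun i => hcm (i + 1)] at h
  linarith

lemma mem_Aq'_of_qval_add_one_le (hq : q ∈ Set.Ioc 1 ((m : ℝ) + 1)) (hc : c ∈ Uq' m q)
    (h : qval q c + 1 ≤ m / (q - 1)) : c ∈ Aq' m q := by
  refine ⟨hc, fun a ha => ?_⟩
  have hq1 := hq.1
  have ha0 := sub_one_le_of_isQuasiGreedy hq ha
  by_contra! hle
  have hle' : (a 0 : ℝ) ≤ c 0 := by exact_mod_cast hle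
  have hcm := (mem_Uq'_iff.1 hc).1
  have hpos : 0 < c 0 := by exact_mod_cast (by linarith : (0 : ℝ) < c 0)
  have hv : q * ((m : ℝ) / (q - 1)) = m / (q - 1) + m := by
    field_simp [(by linarith : q - 1 ≠ 0)]
    ring
  have h1 := lt_qval_tail_add_one hq hc hpos
  have h2 := mul_qval hq1 hcm
  have h3 := mul_le_mul_of_nonneg_left h (by linarith : 0 ≤ q)
  have hlt : c 0 < m := by
    have : (c 0 : ℝ) < m := by linarith
    exact_mod_cast this
  have h4 := qval_tail_lt_one hq hc hlt
  have h5 : (m : ℝ) / (q - 1) < 2 := by linarith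
  rw [div_lt_iff₀ (by linarith)] at h5
  linarith

lemma qval_lt_one_of_mem_Aq' (hq : q ∈ Set.Ioc 1 ((m : ℝ) + 1)) (hc : c ∈ Aq' m q) :
    qval q c < 1 := by
  obtain ⟨a, ha, -, haq⟩ := exists_isQuasiGreedy hq
  have h0 := hc.2 a ha
  have h1 := qval_tail_lt_one hq hc.1 (h0.trans_le (ha.1.1 0))
  have h2 := mul_qval hq.1 (mem_Uq'_iff.1 hc.1).1
  have h3 : (c 0 : ℝ) + 1 ≤ a 0 := by exact_mod_cast h0
  by_contra! h
  have := mul_le_mul_of_nonneg_left h (by linarith [hq.1] : 0 ≤ q)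
  linarith

lemma fcd_eq_zero_iff (hq : 1 < q) (hc : ∀ i, c i ≤ m) (hd : ∀ i, d i ≤ m) :
    fcd m c d q = 0 ↔ 1 + qval q c + qval q d = m / (q - 1) := by
  have hq0 : q ≠ 0 := by linarith
  have hq1 : q - 1 ≠ 0 := by linarith
  have hsum : ∑' i : ℕ, ((c i : ℝ) + (d i : ℝ)) / q ^ (i + 2) = (qval q c + qval q d) / q := by
    unfold qval
    rw [← (summable_digits hq hc).tsum_add (summable_digits hq hd), ← tsum_div_const]
    refine tsum_congr fun i => ?_
    rw [pow_succ q (i + 1), ← div_div, add_div]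
  have hfcd : fcd m c d q = (1 + qval q c + qval q d - m / (q - 1)) / q := by
    rw [fcd, hsum]
    field_simp
    ring
  rw [hfcd, div_eq_zero_iff, or_iff_left hq0, sub_eq_zero]

/-- `a` and `b` expand the same number, which has no further expansion. -/
def OnlyExpansions (m : ℕ) (q : ℝ) (a b : ℕ → ℕ) : Prop :=
  (∀ i, a i ≤ m) ∧ (∀ i, b i ≤ m) ∧ qval q a = qval q b ∧
    ∀ c : ℕ → ℕ, (∀ i, c i ≤ m) → qval q c = qval q a → c = a ∨ c = b

lemma OnlyExpansions.swap {a b : ℕ → ℕ} (h : OnlyExpansions m q a b) : OnlyExpansions m q b a :=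
  ⟨h.2.1, h.1, h.2.2.1.symm, fun c hc hv => (h.2.2.2 c hc (hv.trans h.2.2.1.symm)).symm⟩

lemma qval_digitCons_eq (hq : 1 < q) (hc : ∀ i, c i ≤ m) (hd : ∀ i, d i ≤ m)
    (h : qval q d = qval q (fun i => c (i + 1))) : qval q (digitCons (c 0) d) = qval q c := by
  refine mul_left_cancel₀ (by linarith : q ≠ 0) ?_
  rw [mul_qval_digitCons hq hd (hc 0), mul_qval hq hc, h]

lemma OnlyExpansions.exists_first_digit_lt (hq : 1 < q) {a b : ℕ → ℕ}
    (h : OnlyExpansions m q a b) {n : ℕ} (hn : a n ≠ b n) :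
    ∃ a' b', OnlyExpansions m q a' b' ∧ a' 0 < b' 0 := by
  induction n generalizing a b with
  | zero =>
    rcases lt_or_gt_of_ne hn with hlt | hlt
    exacts [⟨a, b, h, hlt⟩, ⟨b, a, h.swap, hlt⟩]
  | succ n ih =>
    by_cases h0 : a 0 = b 0
    · obtain ⟨ha, hb, hab, hall⟩ := h
      refine ih (a := fun i => a (i + 1)) (b := fun i => b (i + 1))
        ⟨fun i => ha _, fun i => hb _, ?_, fun c hc hv => ?_⟩ hn
      · have h1 := mul_qval hq ha
        have h2 := mul_qval hq hb
        rw [hab, h2, h0] at h1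
        linarith
      · rcases hall _ (digitCons_le hc (ha 0)) (qval_digitCons_eq hq ha hc hv) with h | h
        · exact Or.inl (funext fun i => congrFun h (i + 1))
        · exact Or.inr (funext fun i => congrFun h (i + 1))
    · rcases lt_or_gt_of_ne h0 with hlt | hlt
      exacts [⟨a, b, h, hlt⟩, ⟨b, a, h.swap, hlt⟩]

lemma OnlyExpansions.tail_mem_Uq' (hq : 1 < q) {a b : ℕ → ℕ} (h : OnlyExpansions m q a b)
    (h0 : a 0 ≠ b 0) : (fun i => a (i + 1)) ∈ Uq' m q := by
  obtain ⟨ha, -, -, hall⟩ := h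
  refine mem_Uq'_iff.2 ⟨fun i => ha _, fun c hc hv => ?_⟩
  rcases hall _ (digitCons_le hc (ha 0)) (qval_digitCons_eq hq ha hc hv) with h | h
  · exact funext fun i => congrFun h (i + 1)
  · exact absurd (congrFun h 0) h0

lemma OnlyExpansions.first_digit_eq_add_one (hq : q ∈ Set.Ioc 1 ((m : ℝ) + 1)) {a b : ℕ → ℕ}
    (h : OnlyExpansions m q a b) (hlt : a 0 < b 0) : b 0 = a 0 + 1 := by
  obtain ⟨ha, hb, hab, hall⟩ := h
  by_contra hne
  have hgt : a 0 + 1 < b 0 := by omega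
  have hgt' : (a 0 : ℝ) + 1 < b 0 := by exact_mod_cast hgt
  have hj : a 0 + 1 ≤ m := hgt.le.trans (hb 0)
  have h1 := mul_qval hq.1 ha
  have h2 := mul_qval hq.1 hb
  rw [← hab] at h2
  have h3 := qval_le hq.1 fun i => ha (i + 1)
  have h4 := qval_nonneg (c := fun i => b (i + 1)) hq.1
  obtain ⟨g, hg, hgv⟩ := exists_expansion hq
    (x := qval q (fun i => a (i + 1)) - 1) ⟨by linarith, by linarith⟩
  have hval : qval q (digitCons (a 0 + 1) g) = qval q a := by
    refine mul_left_cancel₀ (by linarith [hq.1] : q ≠ 0) ?_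
    rw [mul_qval_digitCons hq.1 hg hj, h1, hgv]
    push_cast
    ring
  rcases hall _ (digitCons_le hg hj) hval with h | h
  · have := congrFun h 0
    simp [digitCons] at this
  · exact hgt.ne (congrFun h 0)

lemma exists_onlyExpansions_of_mem_B2 (hq : 1 < q) (h : q ∈ B2 m) :
    ∃ a b, OnlyExpansions m q a b ∧ a 0 < b 0 := by
  obtain ⟨-, x, -, a, b, hab, ⟨ha, hxa⟩, ⟨hb, hxb⟩, hall⟩ := h
  obtain ⟨n, hn⟩ := Function.ne_iff.1 hab
  exact OnlyExpansions.exists_first_digit_lt hq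
    ⟨ha, hb, hxa.symm.trans hxb, fun c hc hv => hall c ⟨hc, hxa.trans hv.symm⟩⟩ hn

lemma OnlyExpansions.mem_B2 (hq : q ∈ Set.Ioc 1 ((m : ℝ) + 1)) {a b : ℕ → ℕ}
    (h : OnlyExpansions m q a b) (hab : a ≠ b) : q ∈ B2 m :=
  ⟨hq, qval q a, ⟨qval_nonneg hq.1, qval_le hq.1 h.1⟩, a, b, hab, ⟨h.1, rfl⟩, ⟨h.2.1, h.2.2.1⟩,
    fun c hc => h.2.2.2 c hc.1 hc.2.symm⟩

end Values

/-- `q ∈ B_2(m)` iff `f_{c,d}(q) = 0` for some `c, d ∈ A'_q`. -/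
theorem stmt5 (m : ℕ) (hm : 0 < m) (q : ℝ) (hq : q ∈ Set.Ioc 1 ((m : ℝ) + 1)) :
    q ∈ B2 m ↔ ∃ c ∈ Aq' m q, ∃ d ∈ Aq' m q, fcd m c d q = 0 := by
  have hq1 := hq.1
  constructor
  · intro h
    obtain ⟨a, b, hab, hlt⟩ := exists_onlyExpansions_of_mem_B2 hq1 h
    have hstep := hab.first_digit_eq_add_one hq hlt
    have haU := hab.tail_mem_Uq' hq1 hlt.ne
    have hbU := hab.swap.tail_mem_Uq' hq1 hlt.ne'
    have ha := (mem_Uq'_iff.1 haU).1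
    have hb := (mem_Uq'_iff.1 hbU).1
    have hrefl := qval_reflect hq1 ha
    have hval : qval q (fun i => b (i + 1)) + 1 = qval q (fun i => a (i + 1)) := by
      have h1 := mul_qval hq1 hab.1
      have h2 := mul_qval hq1 hab.2.1
      rw [hab.2.2.1, h2, hstep] at h1
      push_cast at h1
      linarith
    refine ⟨_, mem_Aq'_of_qval_add_one_le hq hbU ?_,
      _, mem_Aq'_of_qval_add_one_le hq (reflect_mem_Uq' hq1 haU) ?_,
      (fcd_eq_zero_iff hq1 hb fun i => Nat.sub_le _ _).2 ?_⟩
    · linarith [qval_le hq1 ha]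
    · linarith [qval_nonneg (c := fun i => b (i + 1)) hq1]
    · linarith
  · rintro ⟨c, hc, d, hd, h⟩
    have hcm := (mem_Uq'_iff.1 hc.1).1
    have hdm := (mem_Uq'_iff.1 hd.1).1
    rw [fcd_eq_zero_iff hq1 hcm hdm] at h
    have heU := reflect_mem_Uq' hq1 hd.1
    have he := qval_reflect hq1 hdm
    set e : ℕ → ℕ := fun i => m - d i
    have hem := (mem_Uq'_iff.1 heU).1
    have h1 := mul_qval_digitCons hq1 hcm (j := 1) hm
    have h0 := mul_qval_digitCons hq1 hem (j := 0) hm.le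
    push_cast at h0 h1
    refine OnlyExpansions.mem_B2 hq (a := digitCons 0 e) (b := digitCons 1 c)
      ⟨digitCons_le hem hm.le, digitCons_le hcm hm, ?_, fun g hg hv => ?_⟩
      fun hne => zero_ne_one (congrFun hne 0)
    · refine mul_left_cancel₀ (by linarith : q ≠ 0) ?_
      linarith
    · have hgv := mul_qval hq1 hg
      rw [hv, h0] at hgv
      rw [← digitCons_tail g]
      have hg0 : g 0 < 2 := by
        by_contra! hge
        have hge' : (2 : ℝ) ≤ g 0 := by exact_mod_cast hge
        linarith [qval_lt_one_of_mem_Aq' hq hc, qval_nonneg (c := fun i => g (i + 1)) hq1]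
      interval_cases hg00 : g 0
      · left
        rw [(mem_Uq'_iff.1 heU).2 _ (fun i => hg (i + 1)) (by push_cast at hgv; linarith)]
      · right
        rw [(mem_Uq'_iff.1 hc.1).2 _ (fun i => hg (i + 1)) (by push_cast at hgv; linarith)]
end
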